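/- Let n ≥ 2 be an even integer. For every pair (x,y) ∈ [0,n²] × [0,n²] with x + y = n², there exists φ ∈ [0,2π]ⁿ such that ȷ₁(φ) = x and ȷ₂(φ) = y. -/

import Mathlib

open Finset Real

/-- ȷ₁(φ) = n + 2·Σ_{0≤k<ℓ≤n−1} cos(φ_ℓ − φ_k) -/
noncomputable def j1 (n : ℕ) (φ : Fin n → ℝ) : ℝ :=
  n + 2 * ∑ l : Fin n, ∑ k : Fin n, if k < l then Real.cos (φ l - φ k) else 0

/-- ȷ₂(φ) = n + 2·Σ_{0≤k<ℓ≤n−1} cos(π(ℓ−k) + φ_ℓ − φ_k) -/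
noncomputable def j2 (n : ℕ) (φ : Fin n → ℝ) : ℝ :=
  n + 2 * ∑ l : Fin n, ∑ k : Fin n,
    if k < l then Real.cos (Real.pi * (((l : ℕ) - (k : ℕ) : ℕ) : ℝ) + (φ l - φ k)) else 0

theorem aux_sq (n : ℕ) (ψ : Fin n → ℝ) :
    (n : ℝ) + 2 * ∑ l : Fin n, ∑ k : Fin n, (if k < l then Real.cos (ψ l - ψ k) else 0)
      = (∑ l, Real.cos (ψ l)) ^ 2 + (∑ l, Real.sin (ψ l)) ^ 2 := by
  have h1 : (∑ l, Real.cos (ψ l)) ^ 2 + (∑ l, Real.sin (ψ l)) ^ 2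
      = ∑ l, ∑ k, Real.cos (ψ l - ψ k) := by
    simp only [sq, Finset.sum_mul_sum, Real.cos_sub, Finset.sum_add_distrib]
  have h2 : ∀ l k : Fin n, Real.cos (ψ l - ψ k) =
      (if k < l then Real.cos (ψ l - ψ k) else 0) + (if l < k then Real.cos (ψ k - ψ l) else 0)
        + (if l = k then 1 else 0) := by
    intro l k
    rcases lt_trichotomy k l with h | h | h
    · simp [h, h.le, h.ne', not_lt.mpr h.le]
    · simp [h]
    · simp [h, h.ne, not_lt.mpr h.le]
      rw [← Real.cos_neg]; congr 1; ring
  have h3 : ∑ l : Fin n, ∑ k : Fin n, (if l < k then Real.cos (ψ k - ψ l) else 0)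
      = ∑ l : Fin n, ∑ k : Fin n, (if k < l then Real.cos (ψ l - ψ k) else 0) :=
    Finset.sum_comm
  rw [h1, Finset.sum_congr rfl fun l _ => Finset.sum_congr rfl fun k _ => h2 l k]
  simp only [Finset.sum_add_distrib]
  rw [h3]
  simp
  ring

theorem aux_sum (m : ℕ) (a b : ℝ) :
    ∑ i : Fin (m + m), (if Even (i : ℕ) then a else b) = m * (a + b) := by
  rw [Fin.sum_univ_eq_sum_range (fun i => if Even i then a else b)]
  induction m with
  | zero => simp
  | succ m ih =>
    rw [show m + 1 + (m + 1) = m + m + 1 + 1 by ring, Finset.sum_range_succ,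
      Finset.sum_range_succ, ih]
    have : Even (m + m) := ⟨m, rfl⟩
    have h2 : ¬ Even (m + m + 1) := by simp [Nat.even_add_one]
    rw [if_pos this, if_neg h2]
    push_cast; ring

theorem surjectivity_on_front (n : ℕ) (hn : 2 ≤ n) (hev : Even n) (x y : ℝ)
    (hx : x ∈ Set.Icc (0 : ℝ) ((n : ℝ) ^ 2)) (hy : y ∈ Set.Icc (0 : ℝ) ((n : ℝ) ^ 2))
    (hxy : x + y = (n : ℝ) ^ 2) :
    ∃ φ : Fin n → ℝ, (∀ k, φ k ∈ Set.Icc (0 : ℝ) (2 * Real.pi)) ∧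
      j1 n φ = x ∧ j2 n φ = y := by
  obtain ⟨m, rfl⟩ := hev
  have hm : (0 : ℝ) < m := by
    have : 0 < m := by omega
    exact_mod_cast this
  obtain ⟨hx0, hx1⟩ := hx
  push_cast at hx1 hxy
  obtain ⟨θ, hθ0, hθ1, hc⟩ : ∃ θ : ℝ, 0 ≤ θ ∧ θ ≤ Real.pi ∧
      Real.cos θ = x / (2 * m ^ 2) - 1 := by
    refine ⟨_, Real.arccos_nonneg _, Real.arccos_le_pi _, Real.cos_arccos ?_ ?_⟩
    · have : 0 ≤ x / (2 * (m : ℝ) ^ 2) := by positivity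
      linarith
    · have : x / (2 * (m : ℝ) ^ 2) ≤ 2 := by
        rw [div_le_iff₀ (by positivity)]; nlinarith
      linarith
  have hx' : x = 2 * m ^ 2 * (1 + Real.cos θ) := by
    rw [hc]; field_simp; ring
  have hs := Real.sin_sq_add_cos_sq θ
  refine ⟨fun i => if Even (i : ℕ) then 0 else θ, ?_, ?_, ?_⟩
  · intro k
    have := Real.pi_pos
    dsimp only
    split_ifs
    · constructor <;> linarith
    · constructor <;> linarith
  · rw [j1, aux_sq]
    simp only [apply_ite Real.cos, apply_ite Real.sin, aux_sum]
    rw [hx', Real.cos_zero, Real.sin_zero]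
    linear_combination (m : ℝ) ^ 2 * hs
  · have key : j2 (m + m) (fun i => if Even (i : ℕ) then 0 else θ) =
        ((m + m : ℕ) : ℝ) + 2 * ∑ l : Fin (m + m), ∑ k : Fin (m + m), (if k < l then
          Real.cos ((fun i : Fin (m + m) => Real.pi * (i : ℕ) + if Even (i : ℕ) then 0 else θ) l -
           (fun i : Fin (m + m) => Real.pi * (i : ℕ) + if Even (i : ℕ) then 0 else θ) k)
           else 0) := by
      rw [j2]
      congr 2
      refine Finset.sum_congr rfl fun l _ => Finset.sum_congr rfl fun k _ => ?_
      by_cases h : k < l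
      · rw [if_pos h, if_pos h, Nat.cast_sub (Fin.lt_def.mp h).le]
        congr 1; ring
      · rw [if_neg h, if_neg h]
    rw [key, aux_sq]
    have hcos : ∀ i : Fin (m + m), Real.cos (Real.pi * (i : ℕ) + if Even (i : ℕ) then 0 else θ)
        = if Even (i : ℕ) then 1 else - Real.cos θ := by
      intro i
      rw [add_comm, mul_comm, Real.cos_add_nat_mul_pi]
      split_ifs with h
      · simp [h.neg_one_pow]
      · simp [(Nat.not_even_iff_odd.mp h).neg_one_pow]
    have hsin : ∀ i : Fin (m + m), Real.sin (Real.pi * (i : ℕ) + if Even (i : ℕ) then 0 else θ)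
        = if Even (i : ℕ) then 0 else - Real.sin θ := by
      intro i
      rw [add_comm, mul_comm, Real.sin_add_nat_mul_pi]
      split_ifs with h
      · simp
      · simp [(Nat.not_even_iff_odd.mp h).neg_one_pow]
    simp only [hcos, hsin, aux_sum]
    linear_combination (m : ℝ) ^ 2 * hs - hxy + hx'
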